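/- arXiv:2003.03748 — 3 statements merged into one kernel-verified Lean document; each statement's English description precedes it below -/
import Mathlib

section
/- The number of orbits of the alternating group A_4 (the alternating group on 4 letters) acting on the set of triples A_4 × A_4 × A_4 (equivalently, functions Fin 3 → A_4) by simultaneous conjugation is exactly 178. (Equivalently, the number of conjugacy classes of homomorphisms from the free group of rank 3 to A_4 is 178.) -/
/-- A tuple is fixed by `g` exactly when each of its entries is. -/
def MulAction.fixedByPiEquiv {G X : Type*} (ι : Type*) [Group G] [MulAction G X] (g : G) :
    MulAction.fixedBy (ι → X) g ≃ (ι → MulAction.fixedBy X g) where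
  toFun f i := ⟨f.1 i, congrFun f.2 i⟩
  invFun f := ⟨fun i => f i, funext fun i => (f i).2⟩
  left_inv _ := rfl
  right_inv _ := rfl

/-- Burnside's lemma for the diagonal action on tuples. -/
theorem MulAction.sum_card_fixedBy_pow_eq_card_orbits_mul_card (G X ι : Type*) [Group G]
    [MulAction G X] [Fintype G] [Finite X] [Fintype ι] :
    ∑ g : G, Nat.card (MulAction.fixedBy X g) ^ Fintype.card ι =
      Nat.card (Quotient (MulAction.orbitRel G (ι → X))) * Nat.card G := by
  classical
  have := Fintype.ofFinite X
  have := Fintype.ofFinite (Quotient (MulAction.orbitRel G (ι → X)))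
  rw [Nat.card_eq_fintype_card, Nat.card_eq_fintype_card,
    ← MulAction.sum_card_fixedBy_eq_card_orbits_mul_card_group]
  refine Finset.sum_congr rfl fun g _ => ?_
  rw [← Nat.card_eq_fintype_card (α := MulAction.fixedBy (ι → X) g),
    Nat.card_congr (MulAction.fixedByPiEquiv ι g), Nat.card_fun,
    Nat.card_eq_fintype_card (α := ι)]

/-- The sum of the cubes of the orders of the centralizers of the elements of `A₄`. -/
theorem sum_card_commute_pow_three_alternatingGroup_four :
    ∑ g : alternatingGroup (Fin 4),
      Fintype.card {h : alternatingGroup (Fin 4) // g * h * g⁻¹ = h} ^ 3 = 178 * 12 := by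
  decide +kernel

/-- The number of orbits of the alternating group `A₄` acting on the set of
triples `A₄ × A₄ × A₄` (as functions `Fin 3 → A₄`) by simultaneous
conjugation `g • (a, b, c) = (g a g⁻¹, g b g⁻¹, g c g⁻¹)` is exactly `178`.
Equivalently, there are `178` conjugacy classes of homomorphisms from the
free group of rank `3` to `A₄`. -/
theorem card_orbits_conj_triples_alternatingGroup_four :
    Nat.card (Quotient (MulAction.orbitRel (ConjAct (alternatingGroup (Fin 4)))
      (Fin 3 → alternatingGroup (Fin 4)))) = 178 := by
  have burnside := MulAction.sum_card_fixedBy_pow_eq_card_orbits_mul_card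
    (ConjAct (alternatingGroup (Fin 4))) (alternatingGroup (Fin 4)) (Fin 3)
  have card_group : Nat.card (ConjAct (alternatingGroup (Fin 4))) = 12 := by
    rw [Nat.card_congr ConjAct.ofConjAct.toEquiv, nat_card_alternatingGroup, Nat.card_fin]
    rfl
  have sum_eq : ∑ g : ConjAct (alternatingGroup (Fin 4)),
      Nat.card (MulAction.fixedBy (alternatingGroup (Fin 4)) g) ^ Fintype.card (Fin 3) =
      178 * 12 := by
    rw [← sum_card_commute_pow_three_alternatingGroup_four, Fintype.card_fin]
    refine Fintype.sum_equiv ConjAct.ofConjAct.toEquiv _ _ fun g => ?_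
    rw [← Nat.card_eq_fintype_card]
    rfl
  rw [sum_eq, card_group] at burnside
  omega
end

section
/- The number of orbits of the alternating group A_5 (the alternating group on 5 letters) acting on the set of triples A_5 × A_5 × A_5 (equivalently, functions Fin 3 → A_5) by simultaneous conjugation is exactly 3675. (Equivalently, the number of conjugacy classes of homomorphisms from the free group of rank 3 to A_5 is 3675.) -/
/-- Under simultaneous conjugation, the tuples fixed by `g` are the tuples of elements commuting
with `g`. -/
theorem ConjAct.card_fixedBy_pi {G ι : Type*} [Group G] [Fintype G] [DecidableEq G] [Fintype ι]
    (g : ConjAct G) :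
    Nat.card (MulAction.fixedBy (ι → G) g) =
      (Finset.univ.filter fun x : G => ofConjAct g * x = x * ofConjAct g).card ^
        Fintype.card ι := by
  classical
  have h : MulAction.fixedBy (ι → G) g = Fintype.piFinset fun _ : ι =>
      Finset.univ.filter fun x : G => ofConjAct g * x = x * ofConjAct g := by
    ext f
    simp [MulAction.mem_fixedBy, funext_iff, ConjAct.smul_def, mul_inv_eq_iff_eq_mul]
  rw [h, Nat.card_coe_set_eq, Set.ncard_coe_finset, Fintype.card_piFinset,
    Finset.prod_const, Finset.card_univ]

/-- Burnside's lemma for simultaneous conjugation of tuples. -/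
theorem ConjAct.card_orbits_pi_mul_card {G ι : Type*} [Group G] [Fintype G] [DecidableEq G]
    [Fintype ι] :
    Nat.card (Quotient (MulAction.orbitRel (ConjAct G) (ι → G))) * Fintype.card G =
      ∑ g : G, (Finset.univ.filter fun x : G => g * x = x * g).card ^ Fintype.card ι := by
  classical
  have h := MulAction.sum_card_fixedBy_eq_card_orbits_mul_card_group (ConjAct G) (ι → G)
  simp only [← Nat.card_eq_fintype_card (α := MulAction.fixedBy _ _),
    ConjAct.card_fixedBy_pi] at h
  rw [Nat.card_eq_fintype_card]
  exact h.symm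

theorem alternatingGroup_five_sum_card_commuting_pow_three :
    ∑ g : alternatingGroup (Fin 5),
      (Finset.univ.filter fun x : alternatingGroup (Fin 5) => g * x = x * g).card ^ 3 =
        220500 := by
  decide +kernel

/-- The number of orbits of the alternating group `A₅` acting on the set of
triples `A₅ × A₅ × A₅` (as functions `Fin 3 → A₅`) by simultaneous
conjugation `g • (a, b, c) = (g a g⁻¹, g b g⁻¹, g c g⁻¹)` is exactly `3675`.
Equivalently, there are `3675` conjugacy classes of homomorphisms from the
free group of rank `3` to `A₅`. -/
theorem card_orbits_conj_triples_alternatingGroup_five :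
    Nat.card (Quotient (MulAction.orbitRel (ConjAct (alternatingGroup (Fin 5)))
      (Fin 3 → alternatingGroup (Fin 5)))) = 3675 := by
  have h := ConjAct.card_orbits_pi_mul_card (G := alternatingGroup (Fin 5)) (ι := Fin 3)
  have hc : Fintype.card (alternatingGroup (Fin 5)) = 60 := by
    rw [← Nat.card_eq_fintype_card, nat_card_alternatingGroup]
    simp [Nat.factorial]
  rw [hc, Fintype.card_fin, alternatingGroup_five_sum_card_commuting_pow_three] at h
  omega
end

section
/- The number of orbits of the alternating group A_4 (the alternating group on 4 letters) acting by simultaneous conjugation on the set of quadruples {(a, b, c, d) ∈ A_4⁴ : a·b = b·a and c·d = d·c} is exactly 310. (Equivalently, the number of conjugacy classes of homomorphisms from the free product (ℤ × ℤ) ∗ (ℤ × ℤ) to A_4 is 310.) -/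
/-- The quadruples `(a, b, c, d)` of elements of `G` with `a * b = b * a` and `c * d = d * c`,
with `G` acting by simultaneous conjugation. -/
def commutingQuadruples (G : Type*) [Group G] : SubMulAction (ConjAct G) (G × G × G × G) where
  carrier := {p | p.1 * p.2.1 = p.2.1 * p.1 ∧ p.2.2.1 * p.2.2.2 = p.2.2.2 * p.2.2.1}
  smul_mem' g p hp := by
    simpa only [Set.mem_ofPred_eq, Prod.smul_fst, Prod.smul_snd, ← smul_mul', smul_left_cancel_iff]
      using hp

/-- The quadruples fixed by `g` are the pairs of commuting pairs in the centralizer of `g`. -/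
def fixedByCommutingQuadruplesEquiv {G : Type*} [Group G] (g : ConjAct G) :
    MulAction.fixedBy (commutingQuadruples G) g ≃
      {p : G × G // p.1 * p.2 = p.2 * p.1 ∧ g • p = p} ×
        {p : G × G // p.1 * p.2 = p.2 * p.1 ∧ g • p = p} where
  toFun x := by
    have h := congrArg Subtype.val x.2
    simp only [SubMulAction.val_smul, Prod.ext_iff, Prod.smul_fst, Prod.smul_snd] at h
    exact (⟨(x.1.1.1, x.1.1.2.1), x.1.2.1, Prod.ext h.1 h.2.1⟩,
      ⟨x.1.1.2.2, x.1.2.2, Prod.ext h.2.2.1 h.2.2.2⟩)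
  invFun y := ⟨⟨(y.1.1.1, y.1.1.2, y.2.1), y.1.2.1, y.2.2.1⟩, Subtype.ext <|
    Prod.ext (Prod.ext_iff.1 y.1.2.2).1 (Prod.ext (Prod.ext_iff.1 y.1.2.2).2 y.2.2.2)⟩
  left_inv _ := rfl
  right_inv _ := rfl

/-- Burnside's lemma for commuting quadruples under simultaneous conjugation. -/
theorem card_orbits_commutingQuadruples_mul_card (G : Type*) [Group G] [Fintype G]
    [DecidableEq G] :
    Nat.card (MulAction.orbitRel.Quotient (ConjAct G) (commutingQuadruples G)) * Fintype.card G =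
      ∑ g : G, Fintype.card {p : G × G // p.1 * p.2 = p.2 * p.1 ∧
        (g * p.1 * g⁻¹, g * p.2 * g⁻¹) = p} ^ 2 := by
  classical
  have : Fintype (commutingQuadruples G) := Fintype.ofFinite _
  have : Fintype (MulAction.orbitRel.Quotient (ConjAct G) (commutingQuadruples G)) :=
    Fintype.ofFinite _
  rw [Nat.card_eq_fintype_card, ← ConjAct.card (G := G),
    ← MulAction.sum_card_fixedBy_eq_card_orbits_mul_card_group]
  refine (Fintype.sum_equiv ConjAct.toConjAct.toEquiv _ _ fun g => ?_).symm
  rw [sq, ← Fintype.card_prod]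
  exact Fintype.card_congr (fixedByCommutingQuadruplesEquiv (ConjAct.toConjAct g)).symm

theorem sum_sq_card_commuting_pairs_fixed_alternatingGroup_four :
    ∑ g : alternatingGroup (Fin 4),
      Fintype.card {p : alternatingGroup (Fin 4) × alternatingGroup (Fin 4) //
        p.1 * p.2 = p.2 * p.1 ∧ (g * p.1 * g⁻¹, g * p.2 * g⁻¹) = p} ^ 2 = 3720 := by
  decide +kernel

/-- The number of orbits of the alternating group `A₄` acting by simultaneous
conjugation `g • (a, b, c, d) = (g a g⁻¹, g b g⁻¹, g c g⁻¹, g d g⁻¹)` on the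
set of quadruples `(a, b, c, d) ∈ A₄⁴` with `a * b = b * a` and
`c * d = d * c` is exactly `310`.  Equivalently, there are `310` conjugacy
classes of homomorphisms from `(ℤ × ℤ) ∗ (ℤ × ℤ)` to `A₄`. -/
theorem card_orbits_conj_commuting_quadruples_alternatingGroup_four :
    Nat.card (Quot (fun
        (x y : {p : alternatingGroup (Fin 4) × alternatingGroup (Fin 4) ×
                    alternatingGroup (Fin 4) × alternatingGroup (Fin 4) //
                p.1 * p.2.1 = p.2.1 * p.1 ∧
                p.2.2.1 * p.2.2.2 = p.2.2.2 * p.2.2.1}) =>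
      ∃ g : alternatingGroup (Fin 4),
        (g * x.val.1 * g⁻¹, g * x.val.2.1 * g⁻¹,
         g * x.val.2.2.1 * g⁻¹, g * x.val.2.2.2 * g⁻¹) = y.val)) = 310 := by
  have burnside := card_orbits_commutingQuadruples_mul_card (alternatingGroup (Fin 4))
  rw [sum_sq_card_commuting_pairs_fixed_alternatingGroup_four,
    show Fintype.card (alternatingGroup (Fin 4)) = 12 by decide +kernel] at burnside
  refine Eq.trans (Nat.card_congr ?_) (Nat.eq_of_mul_eq_mul_right (by norm_num) burnside :
    _ = 310)
  refine Quot.congr (Equiv.refl _) fun x y => ?_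
  refine Iff.trans ?_ (MulAction.orbitRel (ConjAct _) (commutingQuadruples _)).comm
  exact ⟨fun ⟨g, h⟩ => ⟨ConjAct.toConjAct g, Subtype.ext h⟩,
    fun ⟨g, h⟩ => ⟨ConjAct.ofConjAct g, congrArg Subtype.val h⟩⟩
end
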